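/- arXiv:1101.4469 — 2 statements merged into one kernel-verified Lean document; each statement's English description precedes it below -/
import Mathlib

section
/- The matrix U of the q-Hahn model, defined by U_{2i,m-j} = U_{2i,m+j+1} = ((-1)^i/√2)Q̃_j(q^{-i};α,β,m|q) and U_{2i+1,m-j} = -U_{2i+1,m+j+1} = -((-1)^i/√2)Q̃_j(q^{-i};αq,βq^{-1},m|q) for i,j ∈ {0,…,m}, is orthogonal: UᵀU = UUᵀ = I. -/
open Finset Matrix

/-- The q-shifted factorial `(a;q)_k = (1-a)(1-aq)⋯(1-aq^{k-1})`. -/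
noncomputable def qpoch (a q : ℝ) (k : ℕ) : ℝ := ∏ i ∈ Finset.range k, (1 - a * q ^ i)

/-- The q-Hahn polynomial `Q_n(q^{-x};α,β,m|q)` as a terminating ₃Φ₂ series. -/
noncomputable def qhahnQ (n x : ℕ) (α β : ℝ) (m : ℕ) (q : ℝ) : ℝ :=
  ∑ k ∈ Finset.range (n + 1),
    qpoch (q ^ (-(n : ℤ))) q k * qpoch (α * β * q ^ (n + 1)) q k
        * qpoch (q ^ (-(x : ℤ))) q k /
      (qpoch q q k * qpoch (α * q) q k * qpoch (q ^ (-(m : ℤ))) q k) * q ^ k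

/-- The q-Hahn weight `w(x;α,β,m|q)`. -/
noncomputable def qhahnW (x : ℕ) (α β : ℝ) (m : ℕ) (q : ℝ) : ℝ :=
  qpoch (α * q) q x * qpoch (q ^ (-(m : ℤ))) q x /
    (qpoch q q x * qpoch (q ^ (-(m : ℤ)) / β) q x) * (α * β * q) ^ (-(x : ℤ))

/-- The squared norm `h_n(α,β,m|q)` of the q-Hahn polynomials. -/
noncomputable def qhahnH (n : ℕ) (α β : ℝ) (m : ℕ) (q : ℝ) : ℝ :=
  qpoch (α * β * q ^ 2) q m * qpoch q q n * qpoch (α * β * q ^ (m + 2)) q n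
      * qpoch (β * q) q n * (1 - α * β * q) * (-(α * q)) ^ n /
    (qpoch (β * q) q m * (α * q) ^ m * qpoch (α * q) q n * qpoch (α * β * q) q n
        * qpoch (q ^ (-(m : ℤ))) q n * (1 - α * β * q ^ (2 * n + 1)))
    * q ^ ((n.choose 2 : ℤ) - (m : ℤ) * n)

/-- Orthonormal q-Hahn function `Q̃_n(q^{-x};α,β,m|q)`. -/
noncomputable def qhahnQt (n x : ℕ) (α β : ℝ) (m : ℕ) (q : ℝ) : ℝ :=
  Real.sqrt (qhahnW x α β m q) * qhahnQ n x α β m q / Real.sqrt (qhahnH n α β m q)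

/-- The matrix `U` of eigenvectors in the q-Hahn model, built from q-Hahn polynomials
with parameters `(α,β)` (even rows) and `(αq,βq⁻¹)` (odd rows). -/
noncomputable def qhahnU (α β : ℝ) (m : ℕ) (q : ℝ) :
    Matrix (Fin (2 * m + 2)) (Fin (2 * m + 2)) ℝ :=
  Matrix.of fun r c =>
    let i : ℕ := (r : ℕ) / 2
    let j : ℕ := if (c : ℕ) ≤ m then m - (c : ℕ) else (c : ℕ) - m - 1
    if (r : ℕ) % 2 = 0 then
      ((-1 : ℝ) ^ i / Real.sqrt 2) * qhahnQt j i α β m q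
    else
      (if (c : ℕ) ≤ m then (-1 : ℝ) else 1) * ((-1 : ℝ) ^ i / Real.sqrt 2)
        * qhahnQt j i (α * q) (β / q) m q

/-- The q-deformed couplings: `J_{2k+1} = 2√((1-q^{k+1})(1-q^{m-k})q^{k+1}α)`,
`J_{2k} = 2√((1-αq^{k+1})(1-βq^{m-k})q^k)`. -/
noncomputable def qhahnJ (α β : ℝ) (m : ℕ) (q : ℝ) (r : ℕ) : ℝ :=
  if r % 2 = 0 then
    2 * Real.sqrt ((1 - α * q ^ (r / 2 + 1)) * (1 - β * q ^ (m - r / 2)) * q ^ (r / 2))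
  else
    2 * Real.sqrt ((1 - q ^ (r / 2 + 1)) * (1 - q ^ (m - r / 2)) * q ^ (r / 2 + 1) * α)

/-- The tridiagonal interaction matrix `M_q`. -/
noncomputable def qhahnM (α β : ℝ) (m : ℕ) (q : ℝ) :
    Matrix (Fin (2 * m + 2)) (Fin (2 * m + 2)) ℝ :=
  Matrix.of fun r c =>
    if (r : ℕ) + 1 = (c : ℕ) then qhahnJ α β m q r
    else if (c : ℕ) + 1 = (r : ℕ) then qhahnJ α β m q c
    else 0

/-- The eigenvalues `ε_{m-k} = -2√((1-αq^{k+1})(1-βq^k)q^{m-k})`,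
`ε_{m+k+1} = +2√((1-αq^{k+1})(1-βq^k)q^{m-k})`. -/
noncomputable def qhahnEps (α β : ℝ) (m : ℕ) (q : ℝ) (c : Fin (2 * m + 2)) : ℝ :=
  if (c : ℕ) ≤ m then
    -2 * Real.sqrt ((1 - α * q ^ ((m - (c : ℕ)) + 1)) * (1 - β * q ^ (m - (c : ℕ)))
        * q ^ (m - (m - (c : ℕ))))
  else
    2 * Real.sqrt ((1 - α * q ^ (((c : ℕ) - m - 1) + 1)) * (1 - β * q ^ ((c : ℕ) - m - 1))
        * q ^ (m - ((c : ℕ) - m - 1)))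

lemma qp_zero (a q : ℝ) : qpoch a q 0 = 1 := by simp [qpoch]

lemma qp_succ (a q : ℝ) (k : ℕ) : qpoch a q (k+1) = qpoch a q k * (1 - a * q ^ k) := by
  simp [qpoch, Finset.prod_range_succ]

lemma qp_succ' (a q : ℝ) (k : ℕ) : qpoch a q (k+1) = (1 - a) * qpoch (a * q) q k := by
  simp only [qpoch, Finset.prod_range_succ']
  rw [mul_comm]
  simp [pow_succ, mul_assoc, mul_comm q]

lemma qp_pos (a q : ℝ) (k : ℕ) (hq0 : 0 < q) (hq1 : q < 1) (h0 : 0 < a) (h1 : a < 1) :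
    0 < qpoch a q k := by
  refine Finset.prod_pos fun i _ => ?_
  have : q ^ i ≤ 1 := pow_le_one₀ hq0.le hq1.le
  have : 0 < q ^ i := pow_pos hq0 i
  nlinarith

lemma qp_neg_ne (q : ℝ) (m k : ℕ) (hq0 : 0 < q) (hq1 : q < 1) (h : k ≤ m) :
    qpoch (q ^ (-(m : ℤ))) q k ≠ 0 := by
  refine Finset.prod_ne_zero_iff.2 fun i hi => ?_
  have hi : i < m := lt_of_lt_of_le (Finset.mem_range.1 hi) h
  have h1 : q ^ m < q ^ i := pow_lt_pow_right_of_lt_one₀ hq0 hq1 hi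
  have h2 : 0 < q ^ m := pow_pos hq0 m
  rw [_root_.zpow_neg, zpow_natCast]
  intro h
  field_simp at h
  linarith

/-- generic series -/
noncomputable def serR (n : ℕ) (A B a M q y : ℝ) : ℝ :=
  ∑ k ∈ Finset.range (n + 1),
    qpoch A q k * qpoch B q k * qpoch y q k / (qpoch q q k * qpoch a q k * qpoch M q k) * q ^ k

lemma serR_zero (A B a M q y : ℝ) : serR 0 A B a M q y = 1 := by
  simp [serR, qp_zero]

lemma serR_fwd (n : ℕ) (A B a M q y : ℝ) (hq0 : 0 < q) (hq1 : q < 1) :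
    serR (n+1) A B a M q y - serR (n+1) A B a M q (y * q) =
      - (y * q * (1 - A) * (1 - B)) / ((1 - a) * (1 - M)) *
        serR n (A * q) (B * q) (a * q) (M * q) q (y * q) := by
  unfold serR
  rw [← Finset.sum_sub_distrib, Finset.sum_range_succ', Finset.mul_sum]
  simp only [qp_zero, sub_self, add_zero]
  refine Finset.sum_congr rfl fun k _ => ?_
  have h1 : 1 - q ^ (k+1) ≠ 0 := by
    have := pow_lt_one₀ hq0.le hq1 (Nat.succ_ne_zero k)
    simp at this ⊢
    linarith
  have e1 : qpoch y q (k+1) - qpoch (y * q) q (k+1) =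
      - qpoch (y * q) q k * y * (1 - q ^ (k+1)) := by
    rw [qp_succ', qp_succ]; ring
  have e2 : qpoch q q (k+1) = qpoch q q k * (1 - q ^ (k+1)) := by rw [qp_succ]; ring
  calc _ = qpoch A q (k+1) * qpoch B q (k+1) * (qpoch y q (k+1) - qpoch (y * q) q (k+1)) /
      (qpoch q q (k+1) * qpoch a q (k+1) * qpoch M q (k+1)) * q ^ (k+1) := by ring
    _ = _ := by
      rw [e1, e2, qp_succ' A, qp_succ' B, qp_succ' a, qp_succ' M]
      generalize qpoch (y * q) q k = z1
      generalize qpoch (A * q) q k = z2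
      generalize qpoch (B * q) q k = z3
      generalize qpoch (a * q) q k = z4
      generalize qpoch (M * q) q k = z5
      generalize qpoch q q k = z6
      generalize 1 - q ^ (k+1) = z7 at *
      rw [pow_succ]
      have : z7 / z7 = 1 := div_self h1
      calc _ = -(y * q * (1 - A) * (1 - B)) / ((1 - a) * (1 - M)) *
          (z2 * z3 * z1 / (z6 * z4 * z5) * q ^ k) * (z7 / z7) := by
            simp only [div_eq_mul_inv, mul_inv]; ring
        _ = _ := by rw [this, mul_one]

lemma serR_bwd (n : ℕ) (A B a b M q y : ℝ) (hq0 : 0 < q) (hq1 : q < 1)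
    (hAB : A * B * q = a * b) (hA : A * q ^ (n+1) = 1)
    (ha : ∀ k ≤ n + 1, qpoch a q k ≠ 0) (hM : ∀ k ≤ n + 1, qpoch M q k ≠ 0) :
    (y - a) * (y - M) * serR n (A * q) (B * q) (a * q) (M * q) q y
      + a * (b * y - M) * (1 - y) * serR n (A * q) (B * q) (a * q) (M * q) q (y * q)
    = y * (1 - a) * (1 - M) * serR (n+1) A B a M q y := by
  have hqn : ∀ k, qpoch q q k ≠ 0 := fun k => (qp_pos q q k hq0 hq1 hq0 hq1).ne'
  have ha1 : 1 - a ≠ 0 := by simpa [qp_succ, qp_zero] using ha 1 (by omega)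
  have hM1 : 1 - M ≠ 0 := by simpa [qp_succ, qp_zero] using hM 1 (by omega)
  set d : ℕ → ℝ := fun k => qpoch (A * q) q k * qpoch (B * q) q k /
    (qpoch q q k * qpoch (a * q) q k * qpoch (M * q) q k) with hd
  set u : ℕ → ℝ := fun k => d k * (1 - a * q ^ k) * (1 - M * q ^ k) with hu
  set v : ℕ → ℝ := fun k => d k * (1 - a * b * q ^ k) with hv
  have hdn : d (n+1) = 0 := by
    have : qpoch (A * q) q (n+1) = 0 := by
      rw [qp_succ, mul_assoc A, ← pow_succ', hA]; ring
    simp [hd, this]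
  have hun : u (n+1) = 0 := by simp [hu, hdn]
  have hL : (y - a) * (y - M) * serR n (A * q) (B * q) (a * q) (M * q) q y
      + a * (b * y - M) * (1 - y) * serR n (A * q) (B * q) (a * q) (M * q) q (y * q)
      = y * (∑ k ∈ Finset.range (n+1), u k * qpoch y q k
        - ∑ k ∈ Finset.range (n+1), v k * qpoch y q (k+1)) := by
    unfold serR
    rw [← Finset.sum_sub_distrib, Finset.mul_sum, Finset.mul_sum, Finset.mul_sum,
      ← Finset.sum_add_distrib]
    refine Finset.sum_congr rfl fun k _ => ?_
    have e1 : (1 - y) * qpoch (y * q) q k = qpoch y q k * (1 - y * q ^ k) := by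
      rw [← qp_succ, qp_succ']
    have : ∀ z, qpoch (A * q) q k * qpoch (B * q) q k * z /
      (qpoch q q k * qpoch (a * q) q k * qpoch (M * q) q k) = d k * z := by
      intro z; simp only [hd]; ring
    rw [this, this]
    simp only [hu, hv]
    rw [qp_succ]
    linear_combination a * (b * y - M) * d k * q ^ k * e1
  rw [hL]
  have hR : (1 - a) * (1 - M) * serR (n+1) A B a M q y =
      ∑ k ∈ Finset.range (n+1+1), u k * qpoch y q k
        - ∑ k ∈ Finset.range (n+1), v k * qpoch y q (k+1) := by
    unfold serR
    rw [Finset.sum_range_succ', Finset.sum_range_succ' (fun k => u k * qpoch y q k)]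
    rw [add_sub_right_comm, ← Finset.sum_sub_distrib, mul_add, Finset.mul_sum]
    congr 1
    · refine Finset.sum_congr rfl fun k hk => ?_
      have hk := Finset.mem_range.1 hk
      have a1 := ha (k+1) (by omega)
      have m1 := hM (k+1) (by omega)
      have a2 := qp_succ' a q (k+1)
      have m2 := qp_succ' M q (k+1)
      rw [qp_succ'] at a1 m1
      have a3 := (mul_ne_zero_iff.1 a1).2
      have m3 := (mul_ne_zero_iff.1 m1).2
      have q1 := hqn k
      have q2 := hqn (k+1)
      rw [qp_succ] at q2
      have q3 := (mul_ne_zero_iff.1 q2).2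
      have key : (1 - a) * (1 - M) * (qpoch A q (k+1) * qpoch B q (k+1) /
        (qpoch q q (k+1) * qpoch a q (k+1) * qpoch M q (k+1)) * q ^ (k+1)) = u (k+1) - v k := by
        have ud : d (k+1) * (1 - a * q ^ (k+1)) * (1 - M * q ^ (k+1)) =
          qpoch (A * q) q (k+1) * qpoch (B * q) q (k+1) /
            (qpoch q q (k+1) * qpoch (a * q) q k * qpoch (M * q) q k) := by
          by_cases hkn : k = n
          · subst hkn
            rw [hdn]
            have : qpoch (A * q) q (k+1) = 0 := by
              rw [qp_succ, mul_assoc A, ← pow_succ', hA]; ring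
            rw [this]; simp
          have a4 := ha (k+1+1) (by omega)
          have m4 := hM (k+1+1) (by omega)
          rw [qp_succ'] at a4 m4
          have a5 := (mul_ne_zero_iff.1 a4).2
          have m5 := (mul_ne_zero_iff.1 m4).2
          simp only [hd]
          have e1 : qpoch (a * q) q (k+1) = qpoch (a * q) q k * (1 - a * q ^ (k+1)) := by
            rw [qp_succ]; ring
          have e2 : qpoch (M * q) q (k+1) = qpoch (M * q) q k * (1 - M * q ^ (k+1)) := by
            rw [qp_succ]; ring
          rw [e1] at a5 ⊢
          rw [e2] at m5 ⊢
          have a6 := (mul_ne_zero_iff.1 a5).2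
          have m6 := (mul_ne_zero_iff.1 m5).2
          generalize 1 - a * q ^ (k+1) = z1 at *
          generalize 1 - M * q ^ (k+1) = z2 at *
          field_simp
        simp only [hu, ud]
        simp only [hv, hd, ← hAB]
        rw [qp_succ' A, qp_succ' B, qp_succ' a, qp_succ' M, qp_succ (A * q), qp_succ (B * q),
          qp_succ q]
        field_simp
        ring
      calc _ = (1 - a) * (1 - M) * (qpoch A q (k+1) * qpoch B q (k+1) /
        (qpoch q q (k+1) * qpoch a q (k+1) * qpoch M q (k+1)) * q ^ (k+1)) * qpoch y q (k+1) := by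
            ring
        _ = _ := by rw [key]; ring
    · simp [hu, hd, qp_zero]
  rw [Finset.sum_range_succ, hun, zero_mul, add_zero] at hR
  rw [← hR]; ring

/-- normalised weight -/
noncomputable def wt (a b q : ℝ) (N x : ℕ) : ℝ :=
  qpoch a q x * qpoch b q (N - x) / (qpoch q q x * qpoch q q (N - x)) / a ^ x

lemma one_sub_pow_ne (q : ℝ) (k : ℕ) (hq0 : 0 < q) (hq1 : q < 1) : 1 - q ^ (k+1) ≠ 0 := by
  have := pow_lt_one₀ hq0.le hq1 (Nat.succ_ne_zero k)
  simp at this ⊢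
  linarith

lemma wt_pos (a b q : ℝ) (N x : ℕ) (hq0 : 0 < q) (hq1 : q < 1) (ha0 : 0 < a) (ha1 : a < 1)
    (hb0 : 0 < b) (hb1 : b < 1) : 0 < wt a b q N x := by
  have h1 := qp_pos a q x hq0 hq1 ha0 ha1
  have h2 := qp_pos b q (N-x) hq0 hq1 hb0 hb1
  have h3 := qp_pos q q x hq0 hq1 hq0 hq1
  have h4 := qp_pos q q (N-x) hq0 hq1 hq0 hq1
  unfold wt; positivity

lemma qhahnW_eq (x N : ℕ) (α β q : ℝ) (hq0 : 0 < q) (hq1 : q < 1) (hα0 : 0 < α)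
    (hβ0 : 0 < β) (hb1 : β * q < 1) (hx : x ≤ N) :
    qhahnW x α β N q = qpoch q q N / qpoch (β * q) q N * wt (α * q) (β * q) q N x := by
  have hqn : ∀ k, qpoch q q k ≠ 0 := fun k => (qp_pos q q k hq0 hq1 hq0 hq1).ne'
  have hbn : ∀ k, qpoch (β * q) q k ≠ 0 := fun k => (qp_pos _ q k hq0 hq1 (by positivity) hb1).ne'
  induction x with
  | zero =>
    have := hqn N
    have := hbn N
    simp only [qhahnW, wt, qp_zero, Nat.sub_zero]
    generalize qpoch q q N = z1 at *
    generalize qpoch (β * q) q N = z2 at *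
    simp
    field_simp
  | succ x ih =>
    obtain ⟨j, rfl⟩ : ∃ j, N = x + 1 + j := ⟨N - (x+1), by omega⟩
    have ih := ih (by omega)
    have e1 : qhahnW (x+1) α β (x+1+j) q = qhahnW x α β (x+1+j) q *
      ((1 - α * q * q ^ x) * (1 - q ^ (-((x+1+j : ℕ):ℤ)) * q ^ x) /
       ((1 - q * q ^ x) * (1 - q ^ (-((x+1+j:ℕ):ℤ)) / β * q ^ x)) * (α * β * q)⁻¹) := by
      unfold qhahnW
      have : (α * β * q) ^ (-((x+1:ℕ):ℤ)) = (α * β * q) ^ (-((x:ℕ):ℤ)) * (α * β * q)⁻¹ := by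
        rw [← _root_.zpow_neg_one, ← zpow_add₀ (by positivity)]
        congr 1; push_cast; ring
      rw [this, qp_succ, qp_succ, qp_succ, qp_succ]
      simp only [div_eq_mul_inv, mul_inv]; ring
    have e2 : q ^ (-((x+1+j : ℕ):ℤ)) * q ^ x = (q ^ (j+1))⁻¹ := by
      rw [← zpow_natCast, ← zpow_natCast, ← _root_.zpow_neg, ← zpow_add₀ hq0.ne']
      congr 1; push_cast; ring
    have e3 : q ^ (-((x+1+j : ℕ):ℤ)) / β * q ^ x = (β * q ^ (j+1))⁻¹ := by
      rw [mul_inv, ← e2]; ring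
    rw [e1, e2, e3, ih]
    have s1 : x + 1 + j - x = j + 1 := by omega
    have s2 : x + 1 + j - (x+1) = j := by omega
    unfold wt
    rw [s1, s2, qp_succ (β * q) q j, qp_succ q q j, qp_succ (α * q) q x, qp_succ q q x]
    have n1 := hqn (x+1+j)
    have n2 := hbn (x+1+j)
    have n3 := hqn j
    have n4 := hqn x
    have n5 := one_sub_pow_ne q j hq0 hq1
    have n6 := one_sub_pow_ne q x hq0 hq1
    have n7 := hbn (j+1)
    rw [qp_succ] at n7
    have n8 := (mul_ne_zero_iff.1 n7).2
    have n9 := (mul_ne_zero_iff.1 n7).1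
    have r1 : 1 - (q ^ (j+1))⁻¹ = - (1 - q ^ (j+1)) / q ^ (j+1) := by field_simp; ring
    have r2 : 1 - (β * q ^ (j+1))⁻¹ = - (1 - β * q * q ^ j) / (β * q ^ (j+1)) := by
      field_simp; ring
    rw [r1, r2]
    rw [show q * q ^ j = q ^ (j+1) by ring, show q * q ^ x = q ^ (x+1) by ring]
    generalize qpoch q q (x+1+j) = z1 at *
    generalize qpoch (β * q) q (x+1+j) = z2 at *
    generalize qpoch (β * q) q j = z3 at *
    generalize qpoch (α * q) q x = z4 at *
    generalize qpoch q q j = z5 at *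
    generalize qpoch q q x = z6 at *
    generalize 1 - β * q * q ^ j = z7 at *
    generalize 1 - q ^ (j+1) = z8 at *
    generalize 1 - q ^ (x+1) = z9 at *
    generalize 1 - α * q * q ^ x = z10 at *
    field_simp
    ring

lemma vandermonde (a b q : ℝ) (N : ℕ) (hq0 : 0 < q) (hq1 : q < 1) (ha : a ≠ 0) :
    ∑ x ∈ Finset.range (N+1), wt a b q N x = qpoch (a * b) q N / (qpoch q q N * a ^ N) := by
  have hqn : ∀ k, qpoch q q k ≠ 0 := fun k => (qp_pos q q k hq0 hq1 hq0 hq1).ne'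
  induction N with
  | zero => simp [wt, qp_zero]
  | succ N ih =>
    have t1 : ∀ x ∈ Finset.range (N+1), (1 - q ^ (x+1)) * wt a b q (N+1) (x+1)
        = wt a b q N x * (1 - a * q ^ x) / a := by
      intro x hx
      have n1 := hqn x
      have n2 := hqn (N-x)
      have n3 := one_sub_pow_ne q x hq0 hq1
      unfold wt
      rw [Nat.succ_sub_succ, qp_succ, qp_succ, show q * q ^ x = q ^ (x+1) by ring]
      generalize qpoch q q x = z1 at *
      generalize qpoch q q (N-x) = z2 at *
      generalize 1 - q ^ (x+1) = z3 at *
      field_simp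
      ring
    have t2 : ∀ x ∈ Finset.range (N+1), q ^ x * (1 - q ^ (N+1-x)) * wt a b q (N+1) x
        = wt a b q N x * (q ^ x - b * q ^ N) := by
      intro x hx
      have hx := Finset.mem_range.1 hx
      obtain ⟨j, rfl⟩ : ∃ j, N = x + j := ⟨N - x, by omega⟩
      have n1 := hqn x
      have n2 := hqn j
      have n3 := one_sub_pow_ne q j hq0 hq1
      unfold wt
      rw [show x + j + 1 - x = j + 1 by omega, show x + j - x = j by omega,
        qp_succ, qp_succ, show q * q ^ j = q ^ (j+1) by ring, pow_add q x j]
      generalize qpoch q q x = z1 at *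
      generalize qpoch q q j = z2 at *
      generalize 1 - q ^ (j+1) = z3 at *
      field_simp
    have main : (1 - q ^ (N+1)) * ∑ x ∈ Finset.range (N+1+1), wt a b q (N+1) x =
        (1 - a * b * q ^ N) / a * ∑ x ∈ Finset.range (N+1), wt a b q N x := by
      have : (1 - q ^ (N+1)) * ∑ x ∈ Finset.range (N+1+1), wt a b q (N+1) x =
        ∑ x ∈ Finset.range (N+1+1), (1 - q ^ x) * wt a b q (N+1) x +
        ∑ x ∈ Finset.range (N+1+1), q ^ x * (1 - q ^ (N+1-x)) * wt a b q (N+1) x := by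
        rw [Finset.mul_sum, ← Finset.sum_add_distrib]
        refine Finset.sum_congr rfl fun x hx => ?_
        have hx := Finset.mem_range.1 hx
        have : q ^ (N+1) = q ^ x * q ^ (N+1-x) := by rw [← pow_add]; congr 1; omega
        rw [this]; ring
      rw [this, Finset.sum_range_succ', Finset.sum_congr rfl t1, Finset.sum_range_succ _ (N+1),
        Finset.sum_congr rfl t2]
      simp only [pow_zero, sub_self, zero_mul, add_zero, mul_zero, Nat.sub_self]
      rw [← Finset.sum_add_distrib, Finset.mul_sum]
      refine Finset.sum_congr rfl fun x hx => ?_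
      field_simp; ring
    have n1 := one_sub_pow_ne q N hq0 hq1
    have n2 := hqn N
    apply mul_left_cancel₀ n1
    rw [main, ih, qp_succ, qp_succ, show q * q ^ N = q ^ (N+1) by ring]
    generalize qpoch q q N = z1 at *
    generalize 1 - q ^ (N+1) = z2 at *
    generalize qpoch (a * b) q N = z3 at *
    field_simp
    ring

lemma wt_rel1 (a b q : ℝ) (N x : ℕ) (hq0 : 0 < q) (hq1 : q < 1) (ha : a ≠ 0) (hx : x ≤ N) :
    wt a b q (N+1) x * ((1 - a * q ^ x) * (1 - q ^ (N+1-x))) =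
      (1 - a) * (1 - b) * (q ^ x * wt (a * q) (b * q) q N x) := by
  have hqn : ∀ k, qpoch q q k ≠ 0 := fun k => (qp_pos q q k hq0 hq1 hq0 hq1).ne'
  obtain ⟨j, rfl⟩ : ∃ j, N = x + j := ⟨N - x, by omega⟩
  have n1 := hqn x
  have n2 := hqn j
  have n3 := one_sub_pow_ne q j hq0 hq1
  have e1 : qpoch a q x * (1 - a * q ^ x) = (1 - a) * qpoch (a * q) q x := by
    rw [← qp_succ, qp_succ']
  unfold wt
  rw [show x + j + 1 - x = j + 1 by omega, show x + j - x = j by omega,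
        qp_succ' b, qp_succ q q j, show q * q ^ j = q ^ (j+1) by ring, mul_pow a q x]
  generalize qpoch q q x = z1 at *
  generalize qpoch q q j = z2 at *
  generalize 1 - q ^ (j+1) = z3 at *
  generalize qpoch a q x = z4 at *
  generalize qpoch (a * q) q x = z5 at *
  generalize qpoch (b * q) q j = z6 at *
  generalize 1 - a * q ^ x = z7 at *
  field_simp
  linear_combination (1 - b) * z6 * e1

lemma wt_rel2 (a b q : ℝ) (N x : ℕ) (hq0 : 0 < q) (hq1 : q < 1) (ha : a ≠ 0) (hx : x ≤ N) :
    wt a b q (N+1) (x+1) * (a * (1 - b * q ^ (N-x)) * (1 - q ^ (x+1))) =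
      (1 - a) * (1 - b) * (q ^ x * wt (a * q) (b * q) q N x) := by
  have hqn : ∀ k, qpoch q q k ≠ 0 := fun k => (qp_pos q q k hq0 hq1 hq0 hq1).ne'
  have n1 := hqn x
  have n2 := hqn (N-x)
  have n3 := one_sub_pow_ne q x hq0 hq1
  have e1 : qpoch b q (N-x) * (1 - b * q ^ (N-x)) = (1 - b) * qpoch (b * q) q (N-x) := by
    rw [← qp_succ, qp_succ']
  unfold wt
  rw [Nat.succ_sub_succ, qp_succ' a, qp_succ q q x, show q * q ^ x = q ^ (x+1) by ring,
    mul_pow a q x]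
  generalize qpoch q q x = z1 at *
  generalize qpoch q q (N-x) = z2 at *
  generalize 1 - q ^ (x+1) = z3 at *
  generalize qpoch b q (N-x) = z4 at *
  generalize qpoch (b * q) q (N-x) = z5 at *
  generalize qpoch (a * q) q x = z6 at *
  generalize 1 - b * q ^ (N-x) = z7 at *
  rw [pow_succ]
  field_simp
  linear_combination (1 - a) * z6 * e1

lemma qinv_shift (q : ℝ) (k : ℕ) (hq0 : 0 < q) :
    q ^ (-((k+1 : ℕ) : ℤ)) * q = q ^ (-(k : ℤ)) := by
  rw [← zpow_add_one₀ hq0.ne']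
  congr 1; push_cast; ring

lemma qhahnQ_zero (x : ℕ) (α β : ℝ) (m : ℕ) (q : ℝ) : qhahnQ 0 x α β m q = 1 := by
  simp [qhahnQ, qp_zero]

lemma qhahnQ_serR (n x : ℕ) (α β : ℝ) (N : ℕ) (q : ℝ) :
    qhahnQ n x α β N q = serR n (q ^ (-(n : ℤ))) (α * β * q ^ (n + 1)) (α * q)
      (q ^ (-(N : ℤ))) q (q ^ (-(x : ℤ))) := rfl

lemma qhahnQ_serR' (n x : ℕ) (α β : ℝ) (N : ℕ) (q : ℝ) (hq0 : 0 < q) :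
    qhahnQ n x (α * q) (β * q) N q = serR n (q ^ (-((n+1 : ℕ) : ℤ)) * q)
      (α * β * q ^ (n + 1 + 1) * q) (α * q * q)
      (q ^ (-((N+1 : ℕ) : ℤ)) * q) q (q ^ (-(x : ℤ))) := by
  rw [qhahnQ_serR, qinv_shift q _ hq0, qinv_shift q _ hq0]
  congr 1; ring

lemma qhahnQ_fwd (n x : ℕ) (α β : ℝ) (N : ℕ) (q : ℝ) (hq0 : 0 < q) (hq1 : q < 1) :
    q ^ x * (qhahnQ (n+1) x α β (N+1) q - qhahnQ (n+1) (x+1) α β (N+1) q) =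
     q ^ N / q ^ n * (1 - q ^ (n+1)) * (1 - α * β * q ^ (n+2)) / ((1 - α * q) * (1 - q ^ (N+1)))
      * qhahnQ n x (α * q) (β * q) N q := by
  have h := serR_fwd n (q ^ (-((n+1 : ℕ) : ℤ))) (α * β * q ^ (n + 1 + 1)) (α * q)
      (q ^ (-((N+1 : ℕ) : ℤ))) q (q ^ (-((x+1 : ℕ) : ℤ))) hq0 hq1
  rw [qinv_shift q x hq0, ← qhahnQ_serR, ← qhahnQ_serR, ← qhahnQ_serR' n x α β N q hq0] at h
  have e : ∀ k : ℕ, q ^ (-(k : ℤ)) = (q ^ k)⁻¹ := fun k => by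
    rw [_root_.zpow_neg, zpow_natCast]
  have n1 := one_sub_pow_ne q N hq0 hq1
  rw [← neg_sub, h]
  rw [e x, e, e]
  generalize qhahnQ n x (α * q) (β * q) N q = z
  have r1 : ∀ k, 1 - (q ^ (k+1))⁻¹ = - (1 - q ^ (k+1)) / q ^ (k+1) := by
    intro k; field_simp; ring
  rw [r1, r1, show n + 1 + 1 = n + 2 by ring]
  generalize 1 - α * β * q ^ (n+2) = z2
  generalize 1 - α * q = z3
  generalize 1 - q ^ (N+1) = z4 at *
  generalize 1 - q ^ (n+1) = z5 at *
  rw [pow_succ, pow_succ]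
  by_cases h3 : z3 = 0
  · simp [h3]
  field_simp

lemma qhahnQ_bwd (n x : ℕ) (α β : ℝ) (N : ℕ) (q : ℝ) (hq0 : 0 < q) (hq1 : q < 1)
    (hα0 : 0 < α) (hα1 : α * q < 1) (hn : n ≤ N) (hx : x ≤ N + 1) :
    (1 - α * q * q ^ x) * (1 - q ^ (N+1-x)) * qhahnQ n x (α * q) (β * q) N q
      - α * q * (1 - β * q * q ^ (N+1-x)) * (1 - q ^ x) * qhahnQ n (x-1) (α * q) (β * q) N q
    = (1 - α * q) * (1 - q ^ (N+1)) * qhahnQ (n+1) x α β (N+1) q := by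
  have e : ∀ k : ℕ, q ^ (-(k : ℤ)) = (q ^ k)⁻¹ := fun k => by
    rw [_root_.zpow_neg, zpow_natCast]
  have h := serR_bwd n (q ^ (-((n+1 : ℕ) : ℤ))) (α * β * q ^ (n + 1 + 1)) (α * q) (β * q)
      (q ^ (-((N+1 : ℕ) : ℤ))) q (q ^ (-(x : ℤ))) hq0 hq1
      (by rw [e]; field_simp; ring) (by rw [e]; field_simp)
      (fun k _ => (qp_pos _ q k hq0 hq1 (by positivity) hα1).ne')
      (fun k hk => qp_neg_ne q (N+1) k hq0 hq1 (by omega))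
  have hP : (1 - q ^ (-(x:ℤ))) * serR n (q ^ (-((n+1 : ℕ) : ℤ)) * q)
      (α * β * q ^ (n + 1 + 1) * q) (α * q * q)
      (q ^ (-((N+1 : ℕ) : ℤ)) * q) q (q ^ (-(x : ℤ)) * q) =
      (1 - q ^ (-(x:ℤ))) * qhahnQ n (x-1) (α * q) (β * q) N q := by
    rcases x with _ | x
    · simp
    · rw [qinv_shift q x hq0, qhahnQ_serR' n _ α β N q hq0]; rfl
  rw [mul_assoc (α * q * _), hP, ← qhahnQ_serR, ← qhahnQ_serR' n x α β N q hq0] at h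
  rw [e x, e] at h
  have hs : q ^ (N+1) = q ^ x * q ^ (N+1-x) := by rw [← pow_add]; congr 1; omega
  rw [hs] at h ⊢
  generalize qhahnQ n x (α * q) (β * q) N q = z1 at *
  generalize qhahnQ n (x-1) (α * q) (β * q) N q = z2 at *
  generalize qhahnQ (n+1) x α β (N+1) q = z3 at *
  have p1 : q ^ x ≠ 0 := by positivity
  have p2 : q ^ (N+1-x) ≠ 0 := by positivity
  generalize q ^ x = X at *
  generalize q ^ (N+1-x) = Y at *
  field_simp at h
  linear_combination -h

lemma sum_step (n : ℕ) (α β : ℝ) (N : ℕ) (q : ℝ) (R : ℕ → ℝ) (hq0 : 0 < q) (hq1 : q < 1)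
    (hα0 : 0 < α) (hα1 : α * q < 1) (hn : n ≤ N) :
    (1 - q ^ (N+1)) * ∑ x ∈ Finset.range (N+1+1),
      wt (α * q) (β * q) q (N+1) x * qhahnQ (n+1) x α β (N+1) q * R x
    = (1 - β * q) * ∑ x ∈ Finset.range (N+1), wt (α * q * q) (β * q * q) q N x *
      qhahnQ n x (α * q) (β * q) N q * (q ^ x * (R x - R (x+1))) := by
  have ha : 1 - α * q ≠ 0 := by linarith
  have ha' : α * q ≠ 0 := by positivity
  apply mul_left_cancel₀ ha
  have h1 : (1 - α * q) * ((1 - q ^ (N+1)) * ∑ x ∈ Finset.range (N+1+1),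
      wt (α * q) (β * q) q (N+1) x * qhahnQ (n+1) x α β (N+1) q * R x) =
      ∑ x ∈ Finset.range (N+1+1), wt (α * q) (β * q) q (N+1) x *
        ((1 - α * q * q ^ x) * (1 - q ^ (N+1-x))) * qhahnQ n x (α * q) (β * q) N q * R x -
      ∑ x ∈ Finset.range (N+1+1), wt (α * q) (β * q) q (N+1) x *
        (α * q * (1 - β * q * q ^ (N+1-x)) * (1 - q ^ x)) *
          qhahnQ n (x-1) (α * q) (β * q) N q * R x := by
    rw [← Finset.sum_sub_distrib, Finset.mul_sum, Finset.mul_sum]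
    refine Finset.sum_congr rfl fun x hx => ?_
    have hx := Finset.mem_range.1 hx
    have := qhahnQ_bwd n x α β N q hq0 hq1 hα0 hα1 hn (by omega)
    linear_combination - wt (α * q) (β * q) q (N+1) x * R x * this
  rw [h1, Finset.sum_range_succ, Finset.sum_range_succ' _ (N+1)]
  simp only [Nat.sub_self, pow_zero, sub_self, mul_zero, zero_mul, add_zero]
  rw [← Finset.sum_sub_distrib, Finset.mul_sum, Finset.mul_sum]
  refine Finset.sum_congr rfl fun x hx => ?_
  have hx := Finset.mem_range.1 hx
  rw [Nat.succ_sub_succ, wt_rel1 _ _ q N x hq0 hq1 ha' (by omega),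
    wt_rel2 _ _ q N x hq0 hq1 ha' (by omega)]
  simp only [Nat.add_sub_cancel]
  ring

lemma qp_add (c q : ℝ) (N n : ℕ) : qpoch c q (N + n) = qpoch c q N * qpoch (c * q ^ N) q n := by
  simp only [qpoch, Finset.prod_range_add]
  congr 1
  refine Finset.prod_congr rfl fun i _ => ?_
  rw [pow_add]; ring

lemma qhahnH_zero (α β : ℝ) (N : ℕ) (q : ℝ) (h : 1 - α * β * q ≠ 0) :
    qhahnH 0 α β N q = qpoch (α * β * q ^ 2) q N / (qpoch (β * q) q N * (α * q) ^ N) := by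
  simp [qhahnH, qp_zero]
  field_simp


lemma qhahnH_succ (n : ℕ) (α β : ℝ) (N : ℕ) (q : ℝ) (hq0 : 0 < q) (hq1 : q < 1)
    (hα0 : 0 < α) (hα1 : α * q < 1) (hβ0 : 0 < β) (hβ1 : β * q < 1) (hab1 : α * β * q < 1)
    (hn : n ≤ N) :
    qhahnH (n+1) α β (N+1) q =
      q ^ N / q ^ n * (1 - q ^ (n+1)) * (1 - α * β * q ^ (n+2)) /
        ((1 - α * q) * (1 - q ^ (N+1))) * ((1 - q * q ^ N) / (1 - q * q ^ N))
      * qhahnH n (α * q) (β * q) N q := by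
  have hab : 0 < α * β * q := by positivity
  have lt1 : ∀ k, α * β * q ^ (k+1) < 1 := by
    intro k
    calc α * β * q ^ (k+1) = (α * β * q) * q ^ k := by ring
      _ ≤ (α * β * q) * 1 := by gcongr; exact pow_le_one₀ hq0.le hq1.le
      _ < 1 := by linarith
  have nN := one_sub_pow_ne q N hq0 hq1
  have hbn : ∀ k, qpoch (β * q) q k ≠ 0 := fun k => (qp_pos _ q k hq0 hq1 (by positivity) hβ1).ne'
  have han : ∀ k, qpoch (α * q) q k ≠ 0 := fun k => (qp_pos _ q k hq0 hq1 (by positivity) hα1).ne'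
  have hcn : ∀ j k, qpoch (α * β * q ^ (j+1)) q k ≠ 0 :=
    fun j k => (qp_pos _ q k hq0 hq1 (by positivity) (lt1 j)).ne'
  have e1 : qpoch (α * β * q ^ 2) q (N+1) * qpoch (α * β * q ^ (N+1+2)) q (n+1) =
      (1 - α * β * q ^ 2) * (1 - α * β * q ^ 3) *
      (qpoch (α * q * (β * q) * q ^ 2) q N * qpoch (α * q * (β * q) * q ^ (N+2)) q n) := by
    have t1 := qp_add (α * β * q ^ 2) q (N+1) (n+1)
    have t2 := qp_add (α * q * (β * q) * q ^ 2) q N n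
    rw [show α * β * q ^ 2 * q ^ (N+1) = α * β * q ^ (N+1+2) by ring] at t1
    rw [show α * q * (β * q) * q ^ 2 * q ^ N = α * q * (β * q) * q ^ (N+2) by ring] at t2
    rw [← t1, ← t2, show N + 1 + (n+1) = N + n + 1 + 1 by ring, qp_succ', qp_succ']
    rw [show α * β * q ^ 2 * q = α * β * q ^ 3 by ring,
      show α * β * q ^ 3 * q = α * q * (β * q) * q ^ 2 by ring]
    ring
  have e2 : qpoch q q (n+1) = qpoch q q n * (1 - q ^ (n+1)) := by rw [qp_succ]; ring
  have e5 : qpoch (α * β * q) q (n+1) * (1 - α * β * q ^ (n+2)) =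
      (1 - α * β * q) * (1 - α * β * q ^ 2) * qpoch (α * q * (β * q) * q) q n := by
    have t := qp_succ (α * β * q) q (n+1)
    rw [show α * β * q * q ^ (n+1) = α * β * q ^ (n+2) by ring] at t
    rw [← t, qp_succ', qp_succ', show α * β * q * q = α * β * q ^ 2 by ring,
      show α * β * q ^ 2 * q = α * q * (β * q) * q by ring]
    ring
  have e : ∀ k : ℕ, q ^ (-(k : ℤ)) = (q ^ k)⁻¹ := fun k => by
    rw [_root_.zpow_neg, zpow_natCast]
  have e6 : qpoch (q ^ (-((N+1:ℕ) : ℤ))) q (n+1) =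
      - (1 - q ^ (N+1)) / q ^ (N+1) * qpoch (q ^ (-(N:ℤ))) q n := by
    rw [qp_succ', qinv_shift q N hq0, e (N+1)]
    congr 1
    field_simp; ring
  have e7 : q ^ (((n+1).choose 2 : ℤ) - ((N+1 : ℕ) : ℤ) * ((n+1 : ℕ) : ℤ)) =
      q ^ ((n.choose 2 : ℤ) - (N : ℤ) * n) / q ^ (N+1) := by
    rw [eq_div_iff (by positivity), ← zpow_natCast, ← zpow_add₀ hq0.ne']
    congr 1
    rw [Nat.choose_succ_succ' n 1]
    push_cast
    simp
    ring
  have e8 : (-(α * q)) ^ (n+1) = - (α * q) * (-(α * q * q)) ^ n / q ^ n := by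
    rw [show -(α * q * q) = (-(α * q)) * q by ring, mul_pow, pow_succ]
    field_simp
  have e9 : (α * q) ^ (N+1) = (α * q) * (α * q * q) ^ N / q ^ N := by
    rw [mul_pow (α * q) q, pow_succ]
    field_simp
  have e10 : α * β * q ^ (2 * (n+1) + 1) = α * q * (β * q) * q ^ (2 * n + 1) := by ring
  have e11 : α * q * (β * q) * q = α * β * q ^ 3 := by ring
  unfold qhahnH
  rw [e6, e7, e8, e9, e10, qp_succ' (β * q) q n, qp_succ' (β * q) q N, qp_succ' (α * q) q n, e2]
  have m1 : 1 - α * q ≠ 0 := by linarith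
  have m2 : 1 - β * q ≠ 0 := by linarith
  have m3 : 1 - α * β * q ≠ 0 := by linarith
  have m4 : 1 - α * β * q ^ 2 ≠ 0 := (sub_pos.2 (lt1 1)).ne'
  have m5 : 1 - α * β * q ^ 3 ≠ 0 := (sub_pos.2 (lt1 2)).ne'
  have m6 : 1 - α * β * q ^ (n+2) ≠ 0 := by linarith [lt1 (n+1)]
  have m7 : 1 - α * q * (β * q) * q ^ (2*n+1) ≠ 0 := by
    have := lt1 (2*(n+1)); rw [e10] at this; linarith
  have m8 := hbn (n+1)
  have m9 := hbn (N+1)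
  have m10 := han (n+1)
  rw [qp_succ'] at m8 m9 m10
  have m8 := (mul_ne_zero_iff.1 m8).2
  have m9 := (mul_ne_zero_iff.1 m9).2
  have m10 := (mul_ne_zero_iff.1 m10).2
  have m11 := hcn 0 (n+1)
  have m12 := hcn 2 n
  rw [show α * β * q ^ (2+1) = α * q * (β * q) * q by ring] at m12
  rw [show α * β * q ^ (0+1) = α * β * q by ring] at m11
  have m13 := qp_neg_ne q N n hq0 hq1 hn
  have e12 : qpoch (α * β * q) q (n+1) = (1 - α * β * q) * (1 - α * β * q ^ 2) *
    qpoch (α * q * (β * q) * q) q n / (1 - α * β * q ^ (n+2)) := by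
    rw [eq_div_iff m6, e5]
  rw [div_self (by rwa [show q * q ^ N = q ^ (N+1) by ring]), mul_one]
  have e1' : ∀ z, qpoch (α * β * q ^ 2) q (N+1) * z * qpoch (α * β * q ^ (N+1+2)) q (n+1) =
      (1 - α * β * q ^ 2) * (1 - α * β * q ^ 3) *
      (qpoch (α * q * (β * q) * q ^ 2) q N * qpoch (α * q * (β * q) * q ^ (N+2)) q n) * z := by
    intro z; rw [← e1]; ring
  rw [e1', e12]
  clear e1 e2 e5 e6 e7 e8 e9 e12 e1' hcn han hbn lt1 e10
  generalize qpoch (α * q * (β * q) * q ^ 2) q N = z1 at *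
  generalize qpoch (α * q * (β * q) * q ^ (N+2)) q n = z2 at *
  generalize qpoch (α * q * (β * q) * q) q n = z3 at *
  generalize qpoch (β * q * q) q N = z4 at *
  generalize qpoch (β * q * q) q n = z5 at *
  generalize qpoch (α * q * q) q n = z6 at *
  generalize qpoch (q ^ (-(N : ℤ))) q n = z7 at *
  generalize q ^ ((n.choose 2 : ℤ) - (N : ℤ) * n) = z8 at *
  rw [e11]
  generalize 1 - α * q * (β * q) * q ^ (2*n+1) = z9 at *
  generalize 1 - α * β * q ^ (n+2) = z10 at *
  generalize 1 - α * β * q ^ 2 = z11 at *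
  generalize 1 - α * β * q ^ 3 = z12 at *
  generalize 1 - α * β * q = z13 at *
  generalize 1 - q ^ (N+1) = z14 at *
  generalize 1 - q ^ (n+1) = z15 at *
  generalize 1 - α * q = z16 at *
  generalize 1 - β * q = z17 at *
  generalize (-(α * q * q)) ^ n = z18 at *
  have m14 : (α * q * q) ^ N ≠ 0 := by positivity
  generalize (α * q * q) ^ N = z19 at *
  have m15 : q ^ N ≠ 0 := by positivity
  have m16 : q ^ n ≠ 0 := by positivity
  have m17 : q ^ (N+1) ≠ 0 := by positivity
  generalize q ^ (N+1) = z20 at *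
  generalize q ^ N = z21 at *
  generalize q ^ n = z22 at *
  generalize qpoch q q n = z23 at *
  field_simp

lemma fac_div (q : ℝ) (N : ℕ) (hq0 : 0 < q) (hq1 : q < 1) :
    (1 - q * q ^ N) / (1 - q * q ^ N) = 1 := by
  have := one_sub_pow_ne q N hq0 hq1
  rw [pow_succ'] at this
  exact div_self this

lemma abq_lt (α β q : ℝ) (k : ℕ) (hq0 : 0 < q) (hq1 : q < 1) (hα0 : 0 < α) (hβ0 : 0 < β)
    (h : α * β * q < 1) : α * β * q ^ (k+1) < 1 := by
  have hab : 0 < α * β * q := by positivity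
  calc α * β * q ^ (k+1) = (α * β * q) * q ^ k := by ring
    _ ≤ (α * β * q) * 1 := by gcongr; exact pow_le_one₀ hq0.le hq1.le
    _ < 1 := by linarith

lemma qhahnH_pos (n : ℕ) : ∀ (α β : ℝ) (N : ℕ) (q : ℝ) (_ : 0 < q) (_ : q < 1)
    (_ : 0 < α) (_ : α * q < 1) (_ : 0 < β) (_ : β * q < 1) (_ : α * β * q < 1)
    (_ : n ≤ N), 0 < qhahnH n α β N q := by
  induction n with
  | zero =>
    intro α β N q hq0 hq1 hα0 hα1 hβ0 hβ1 hab hn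
    rw [qhahnH_zero _ _ _ _ (by linarith)]
    have h1 := qp_pos (β * q) q N hq0 hq1 (by positivity) hβ1
    have h2 := qp_pos (α * β * q ^ 2) q N hq0 hq1 (by positivity)
      (abq_lt α β q 1 hq0 hq1 hα0 hβ0 hab)
    positivity
  | succ n ih =>
    intro α β N q hq0 hq1 hα0 hα1 hβ0 hβ1 hab hn
    obtain ⟨N, rfl⟩ : ∃ M, N = M + 1 := ⟨N - 1, by omega⟩
    rw [qhahnH_succ n α β N q hq0 hq1 hα0 hα1 hβ0 hβ1 hab (by omega), fac_div q N hq0 hq1]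
    have h0 := ih (α * q) (β * q) N q hq0 hq1 (by positivity) (by nlinarith) (by positivity)
      (by nlinarith) (by have := abq_lt α β q 2 hq0 hq1 hα0 hβ0 hab; ring_nf at this ⊢; linarith) (by omega)
    have h1 : 0 < 1 - q ^ (n+1) := by
      have := pow_lt_one₀ hq0.le hq1 (Nat.succ_ne_zero n)
      simp at this ⊢; linarith
    have h2 : 0 < 1 - q ^ (N+1) := by
      have := pow_lt_one₀ hq0.le hq1 (Nat.succ_ne_zero N)
      simp at this ⊢; linarith
    have h3 : 0 < 1 - α * β * q ^ (n+2) := by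
      linarith [abq_lt α β q (n+1) hq0 hq1 hα0 hβ0 hab]
    have h4 : 0 < 1 - α * q := by linarith
    positivity

lemma orth_zero (n : ℕ) (α β : ℝ) (N : ℕ) (q : ℝ) (hq0 : 0 < q) (hq1 : q < 1)
    (hα0 : 0 < α) (hα1 : α * q < 1) (hn : n + 1 ≤ N) :
    ∑ x ∈ Finset.range (N+1), wt (α * q) (β * q) q N x * qhahnQ (n+1) x α β N q = 0 := by
  obtain ⟨N, rfl⟩ : ∃ M, N = M + 1 := ⟨N - 1, by omega⟩
  have h := sum_step n α β N q (fun _ => 1) hq0 hq1 hα0 hα1 (by omega)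
  simp only [sub_self, mul_zero, Finset.sum_const_zero, mul_one] at h
  exact (mul_eq_zero.1 h).resolve_left (one_sub_pow_ne q N hq0 hq1)

lemma orth (n : ℕ) : ∀ (l : ℕ) (α β : ℝ) (N : ℕ) (q : ℝ) (_ : 0 < q) (_ : q < 1)
    (_ : 0 < α) (_ : α * q < 1) (_ : 0 < β) (_ : β * q < 1) (_ : α * β * q < 1)
    (_ : n ≤ N) (_ : l ≤ N),
    ∑ x ∈ Finset.range (N+1), wt (α * q) (β * q) q N x * qhahnQ n x α β N q * qhahnQ l x α β N q
    = if n = l then qpoch (β * q) q N / qpoch q q N * qhahnH n α β N q else 0 := by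
  induction n with
  | zero =>
    intro l α β N q hq0 hq1 hα0 hα1 hβ0 hβ1 hab hn hl
    rcases l with _ | l
    · simp only [qhahnQ_zero, mul_one, if_true]
      rw [vandermonde _ _ q N hq0 hq1 (by positivity), qhahnH_zero _ _ _ _ (by linarith)]
      have h1 := (qp_pos (β * q) q N hq0 hq1 (by positivity) hβ1).ne'
      have h2 := (qp_pos q q N hq0 hq1 hq0 hq1).ne'
      rw [show α * q * (β * q) = α * β * q ^ 2 by ring]
      generalize qpoch (β * q) q N = z1 at *
      generalize qpoch q q N = z2 at *
      generalize qpoch (α * β * q ^ 2) q N = z3 at *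
      field_simp
    · simp only [qhahnQ_zero, mul_one]
      rw [orth_zero l α β N q hq0 hq1 hα0 hα1 hl]
      simp
  | succ n ih =>
    intro l α β N q hq0 hq1 hα0 hα1 hβ0 hβ1 hab hn hl
    rcases l with _ | l
    · simp only [qhahnQ_zero, mul_one]
      rw [orth_zero n α β N q hq0 hq1 hα0 hα1 hn]
      simp
    obtain ⟨N, rfl⟩ : ∃ M, N = M + 1 := ⟨N - 1, by omega⟩
    have ih := ih l (α * q) (β * q) N q hq0 hq1 (by positivity) (by nlinarith) (by positivity)
      (by nlinarith) (by have := abq_lt α β q 2 hq0 hq1 hα0 hβ0 hab; ring_nf at this ⊢; linarith) (by omega)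
      (by omega)
    have nN := one_sub_pow_ne q N hq0 hq1
    apply mul_left_cancel₀ nN
    rw [sum_step n α β N q (fun x => qhahnQ (l+1) x α β (N+1) q) hq0 hq1 hα0 hα1 (by omega)]
    simp only [qhahnQ_fwd l _ α β N q hq0 hq1]
    set F := q ^ N / q ^ l * (1 - q ^ (l+1)) * (1 - α * β * q ^ (l+2)) /
      ((1 - α * q) * (1 - q ^ (N+1))) with hF
    have hs : ∑ x ∈ Finset.range (N+1), wt (α * q * q) (β * q * q) q N x *
      qhahnQ n x (α * q) (β * q) N q * (F * qhahnQ l x (α * q) (β * q) N q) =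
      F * ∑ x ∈ Finset.range (N+1), wt (α * q * q) (β * q * q) q N x *
      qhahnQ n x (α * q) (β * q) N q * qhahnQ l x (α * q) (β * q) N q := by
      rw [Finset.mul_sum]
      exact Finset.sum_congr rfl fun x _ => by ring
    rw [hs, ih]
    by_cases hnl : n = l
    · subst hnl
      simp only [if_true]
      rw [qhahnH_succ n α β N q hq0 hq1 hα0 hα1 hβ0 hβ1 hab (by omega), fac_div q N hq0 hq1,
        mul_one, ← hF, qp_succ' (β * q), qp_succ q q N, ← pow_succ']
      have h2 := (qp_pos q q N hq0 hq1 hq0 hq1).ne'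
      generalize qpoch (β * q * q) q N = z1 at *
      generalize qpoch q q N = z2 at *
      generalize qhahnH n (α * q) (β * q) N q = z3 at *
      clear_value F
      generalize 1 - q ^ (N+1) = z4 at *
      field_simp
    · simp [hnl]

lemma orthQt (n l : ℕ) (α β : ℝ) (N : ℕ) (q : ℝ) (hq0 : 0 < q) (hq1 : q < 1)
    (hα0 : 0 < α) (hα1 : α * q < 1) (hβ0 : 0 < β) (hβ1 : β * q < 1) (hab : α * β * q < 1)
    (hn : n ≤ N) (hl : l ≤ N) :
    ∑ x ∈ Finset.range (N+1), qhahnQt n x α β N q * qhahnQt l x α β N q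
      = if n = l then 1 else 0 := by
  have h := orth n l α β N q hq0 hq1 hα0 hα1 hβ0 hβ1 hab hn hl
  have p1 := qp_pos (β * q) q N hq0 hq1 (by positivity) hβ1
  have p2 := qp_pos q q N hq0 hq1 hq0 hq1
  have hs : ∑ x ∈ Finset.range (N+1), qhahnQt n x α β N q * qhahnQt l x α β N q =
    (qpoch q q N / qpoch (β * q) q N) / (√(qhahnH n α β N q) * √(qhahnH l α β N q)) *
     ∑ x ∈ Finset.range (N+1),
      wt (α * q) (β * q) q N x * qhahnQ n x α β N q * qhahnQ l x α β N q := by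
    rw [Finset.mul_sum]
    refine Finset.sum_congr rfl fun x hx => ?_
    have hx := Finset.mem_range.1 hx
    have hw := qhahnW_eq x N α β q hq0 hq1 hα0 hβ0 hβ1 (by omega)
    have hp := wt_pos (α * q) (β * q) q N x hq0 hq1 (by positivity) hα1 (by positivity) hβ1
    have hW : 0 ≤ qhahnW x α β N q := by rw [hw]; positivity
    unfold qhahnQt
    calc _ = (√(qhahnW x α β N q) * √(qhahnW x α β N q)) /
          (√(qhahnH n α β N q) * √(qhahnH l α β N q)) * qhahnQ n x α β N q * qhahnQ l x α β N q := by
          simp only [div_eq_mul_inv, mul_inv]; ring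
      _ = _ := by rw [Real.mul_self_sqrt hW, hw]; ring
  rw [hs, h]
  split_ifs with hnl
  · subst hnl
    have hH := qhahnH_pos n α β N q hq0 hq1 hα0 hα1 hβ0 hβ1 hab hn
    rw [Real.mul_self_sqrt hH.le]
    generalize qhahnH n α β N q = z3 at *
    generalize qpoch (β * q) q N = z1 at *
    generalize qpoch q q N = z2 at *
    field_simp
  · simp

lemma sum_even_odd (f : ℕ → ℝ) (n : ℕ) :
    ∑ r ∈ Finset.range (2 * n), f r = ∑ i ∈ Finset.range n, (f (2 * i) + f (2 * i + 1)) := by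
  induction n with
  | zero => simp
  | succ n ih =>
    rw [show 2 * (n+1) = 2 * n + 1 + 1 by ring, Finset.sum_range_succ, Finset.sum_range_succ, ih,
      Finset.sum_range_succ]
    ring

theorem qhahnU_orthogonal (m : ℕ) (α β q : ℝ)
    (hq0 : 0 < q) (hq1 : q < 1) (hα0 : 0 < α) (hα1 : α < q⁻¹) (hβ0 : 0 < β) (hβ1 : β < 1) :
    (qhahnU α β m q)ᵀ * qhahnU α β m q = 1 ∧ qhahnU α β m q * (qhahnU α β m q)ᵀ = 1 := by
  have hα1' : α * q < 1 := by
    rw [lt_inv_comm₀ hα0 hq0] at hα1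
    calc α * q < α * α⁻¹ := by gcongr
      _ = 1 := mul_inv_cancel₀ hα0.ne'
  have hab : α * β * q < 1 := by
    calc α * β * q = (α * q) * β := by ring
      _ < 1 * 1 := mul_lt_mul'' hα1' hβ1 (by positivity) hβ0.le
      _ = 1 := by ring
  have key : (qhahnU α β m q)ᵀ * qhahnU α β m q = 1 := by
    ext c c'
    rw [Matrix.mul_apply]
    simp only [Matrix.transpose_apply, qhahnU, Matrix.of_apply]
    set j : ℕ := if (c : ℕ) ≤ m then m - (c : ℕ) else (c : ℕ) - m - 1 with hj
    set j' : ℕ := if (c' : ℕ) ≤ m then m - (c' : ℕ) else (c' : ℕ) - m - 1 with hj'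
    have hjm : j ≤ m := by rw [hj]; split_ifs <;> omega
    have hjm' : j' ≤ m := by rw [hj']; split_ifs <;> omega
    set s : ℝ := if (c : ℕ) ≤ m then (-1 : ℝ) else 1 with hs
    set s' : ℝ := if (c' : ℕ) ≤ m then (-1 : ℝ) else 1 with hs'
    have o1 := orthQt j j' α β m q hq0 hq1 hα0 hα1' hβ0 (by nlinarith) hab hjm hjm'
    have o2 := orthQt j j' (α * q) (β / q) m q hq0 hq1 (by positivity) (by nlinarith)
      (by positivity) (by rw [div_mul_cancel₀ _ hq0.ne']; exact hβ1)
      (by rw [show α * q * (β / q) * q = α * β * q by field_simp]; exact hab) hjm hjm'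
    rw [Fin.sum_univ_eq_sum_range (fun r : ℕ =>
      (if r % 2 = 0 then ((-1 : ℝ) ^ (r / 2) / Real.sqrt 2) * qhahnQt j (r / 2) α β m q
       else s * ((-1 : ℝ) ^ (r / 2) / Real.sqrt 2) * qhahnQt j (r / 2) (α * q) (β / q) m q) *
      (if r % 2 = 0 then ((-1 : ℝ) ^ (r / 2) / Real.sqrt 2) * qhahnQt j' (r / 2) α β m q
       else s' * ((-1 : ℝ) ^ (r / 2) / Real.sqrt 2) * qhahnQt j' (r / 2) (α * q) (β / q) m q))
      (2 * m + 2), show Finset.range (2 * m + 2) = Finset.range (2 * (m + 1)) from rfl,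
      sum_even_odd]
    have h2 : (√2 : ℝ) * √2 = 2 := Real.mul_self_sqrt (by norm_num)
    have hsum : ∀ i : ℕ, ((-1 : ℝ) ^ i / √2) * ((-1 : ℝ) ^ i / √2) = 1 / 2 := by
      intro i
      rw [div_mul_div_comm, h2, ← mul_pow]; norm_num
    trans ∑ i ∈ Finset.range (m+1), ((1 / 2 : ℝ) *
        (qhahnQt j i α β m q * qhahnQt j' i α β m q) + s * s' / 2 *
        (qhahnQt j i (α * q) (β / q) m q * qhahnQt j' i (α * q) (β / q) m q))
    · refine Finset.sum_congr rfl fun i _ => ?_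
      rw [show (2 * i) % 2 = 0 by omega, show (2 * i + 1) % 2 = 1 by omega,
        show 2 * i / 2 = i by omega, show (2 * i + 1) / 2 = i by omega]
      simp only [if_true, one_ne_zero, if_false]
      linear_combination (qhahnQt j i α β m q * qhahnQt j' i α β m q + s * s' *
        (qhahnQt j i (α * q) (β / q) m q * qhahnQt j' i (α * q) (β / q) m q)) * hsum i
    rw [Finset.sum_add_distrib, ← Finset.mul_sum, ← Finset.mul_sum,
      o1, o2, Matrix.one_apply]
    have hcc : c = c' ↔ (c : ℕ) = c' := Fin.ext_iff
    have hc := c.2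
    have hc' := c'.2
    simp only [hcc, hs, hs', hj, hj']
    split_ifs <;> first | omega | norm_num
  exact ⟨key, _root_.mul_eq_one_comm.1 key⟩
end

section
/- Reduction of Hahn to Krawtchouk polynomials (odd case): ₃F₂(-s, s+1, -i; 3/2, -m; 1) = -((-1)^i/(2s+1)) · (C(2m+1,2i+1)/C(m,i)) · ₂F₁(-2i-1, -m-s-1; -2m-1; 2) for integers 0 ≤ i, s ≤ m. -/
open Finset

/-- Pochhammer symbol `(a)_k = a(a+1)⋯(a+k-1)`. -/
noncomputable def poch (a : ℝ) (k : ℕ) : ℝ := ∏ i ∈ Finset.range k, (a + i)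

def ee (s k : ℕ) : ℕ := (s + k + 1).choose (2 * k + 1) + (s + k).choose (2 * k + 1)

lemma ee_zero (s k : ℕ) (h : s < k) : ee s k = 0 := by
  unfold ee
  rw [Nat.choose_eq_zero_of_lt (by omega), Nat.choose_eq_zero_of_lt (by omega)]

lemma choose_rec (n r : ℕ) : (n + 2).choose (r + 2) + n.choose (r + 2)
    = 2 * (n + 1).choose (r + 2) + n.choose r := by
  have h1 := Nat.choose_succ_succ' (n + 1) (r + 1)
  have h2 := Nat.choose_succ_succ' n (r + 1)
  have h3 := Nat.choose_succ_succ' n r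
  simp only [add_assoc, Nat.reduceAdd] at *
  omega

lemma ee_rec (s k : ℕ) : ee (s + 2) (k + 1) + ee s (k + 1)
    = 2 * ee (s + 1) (k + 1) + ee (s + 1) k := by
  unfold ee
  have h1 := choose_rec (s + k + 2) (2 * k + 1)
  have h2 := choose_rec (s + k + 1) (2 * k + 1)
  ring_nf at *
  omega

lemma ee_closed (s k : ℕ) (h : k ≤ s) : (2 * k + 1).factorial * (s - k).factorial * ee s k
    = (2 * s + 1) * (s + k).factorial := by
  obtain ⟨j, rfl⟩ := Nat.exists_eq_add_of_le h
  unfold ee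
  have h1 := Nat.choose_mul_factorial_mul_factorial (n := k + j + k + 1) (k := 2 * k + 1) (by omega)
  rw [show k + j + k + 1 - (2 * k + 1) = j by omega] at h1
  rw [show k + j - k = j by omega]
  rcases j with _ | j
  · rw [Nat.choose_eq_zero_of_lt (n := k + 0 + k) (by omega)]
    rw [Nat.factorial_succ (k + 0 + k)] at h1
    linear_combination h1
  · have h2 := Nat.choose_mul_factorial_mul_factorial (n := k + (j + 1) + k) (k := 2 * k + 1)
      (by omega)
    rw [show k + (j + 1) + k - (2 * k + 1) = j by omega] at h2
    rw [Nat.factorial_succ (k + (j + 1) + k)] at h1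
    have h3 := Nat.factorial_succ j
    linear_combination h1 + (j + 1) * h2 + (2 * k + 1).factorial *
      (k + (j + 1) + k).choose (2 * k + 1) * h3

section
variable {R : Type*} [CommRing R]

lemma T_ext (u v : R) (s N : ℕ) (h : s ≤ N) :
    v ^ (N - s) * ∑ k ∈ range (s + 1), (ee s k : R) * u ^ k * v ^ (s - k)
      = ∑ k ∈ range (N + 1), (ee s k : R) * u ^ k * v ^ (N - k) := by
  rw [mul_sum, ← Finset.sum_subset (Finset.range_mono (Nat.succ_le_succ h))]
  · refine sum_congr rfl fun k hk => ?_
    have hk : k ≤ s := by simpa [Nat.lt_succ_iff] using hk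
    rw [show N - k = (N - s) + (s - k) by omega, pow_add]; ring
  · intro k _ hk
    rw [ee_zero s k (by simpa using hk)]; simp

lemma T_rec (u v : R) (s : ℕ) :
    ∑ k ∈ range (s + 2 + 1), (ee (s + 2) k : R) * u ^ k * v ^ (s + 2 - k)
     = (2 * v + u) * ∑ k ∈ range (s + 1 + 1), (ee (s + 1) k : R) * u ^ k * v ^ (s + 1 - k)
       - v ^ 2 * ∑ k ∈ range (s + 1), (ee s k : R) * u ^ k * v ^ (s - k) := by
  have h1 := T_ext u v (s + 1) (s + 2) (by omega)
  have h2 := T_ext u v s (s + 2) (by omega)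
  rw [show s + 2 - s = 2 by omega] at h2
  rw [show s + 2 - (s + 1) = 1 by omega, pow_one] at h1
  rw [h2, add_mul, mul_assoc, h1]
  rw [sum_range_succ', sum_range_succ' _ (s + 2), sum_range_succ' _ (s + 2)]
  have h3 : u * ∑ k ∈ range (s + 1 + 1), (ee (s + 1) k : R) * u ^ k * v ^ (s + 1 - k)
      = ∑ k ∈ range (s + 2), (ee (s + 1) k : R) * u ^ (k + 1) * v ^ (s + 2 - (k + 1)) := by
    rw [mul_sum]
    refine sum_congr rfl fun k hk => ?_
    rw [show s + 2 - (k + 1) = s + 1 - k by omega]; ring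
  have h4 : ∑ k ∈ range (s + 2), (ee (s + 2) (k + 1) : R) * u ^ (k + 1) * v ^ (s + 2 - (k + 1))
      = 2 * (∑ k ∈ range (s + 2), (ee (s + 1) (k + 1) : R) * u ^ (k + 1) * v ^ (s + 2 - (k + 1)))
       + (∑ k ∈ range (s + 2), (ee (s + 1) k : R) * u ^ (k + 1) * v ^ (s + 2 - (k + 1)))
       - ∑ k ∈ range (s + 2), (ee s (k + 1) : R) * u ^ (k + 1) * v ^ (s + 2 - (k + 1)) := by
    rw [mul_sum, ← sum_add_distrib, ← sum_sub_distrib]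
    refine sum_congr rfl fun k hk => ?_
    have := congrArg (Nat.cast (R := R)) (ee_rec s k)
    push_cast at this
    linear_combination (u ^ (k + 1) * v ^ (s + 2 - (k + 1))) * this
  rw [h3, h4]
  have e0 : ∀ n, ee n 0 = 2 * n + 1 := by intro n; simp [ee]; ring
  simp only [e0]; push_cast; ring

lemma T_eq (z : R) (s : ℕ) :
    (1 + z) ^ (2 * s + 1) - (1 - z) ^ (2 * s + 1) = 2 * z *
      ∑ k ∈ range (s + 1), (ee s k : R) * (4 * z ^ 2) ^ k * (1 - z ^ 2) ^ (s - k) := by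
  induction s using Nat.twoStepInduction with
  | zero => simp [ee]; ring
  | one => simp [ee, sum_range_succ, Nat.choose]; ring
  | more s h1 h2 =>
    rw [T_rec]
    linear_combination (2 * (1 - z ^ 2) + 4 * z ^ 2) * h2 - (1 - z ^ 2) ^ 2 * h1

lemma odd_id (z : R) (m s : ℕ) (hs : s ≤ m) :
    (1 + z) ^ (m + s + 1) * (1 - z) ^ (m - s) - (1 - z) ^ (m + s + 1) * (1 + z) ^ (m - s)
     = 2 * z * ∑ k ∈ range (m + 1), (ee s k : R) * (4 * z ^ 2) ^ k * (1 - z ^ 2) ^ (m - k) := by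
  rw [← T_ext _ _ s m hs]
  have := T_eq z s
  rw [show m + s + 1 = (m - s) + (2 * s + 1) by omega, pow_add, pow_add,
    show 1 - z ^ 2 = (1 + z) * (1 - z) by ring, mul_pow] at *
  linear_combination ((1 + z) ^ (m - s) * (1 - z) ^ (m - s)) * this
end

open Polynomial in
lemma coeff_kraw (x N n : ℕ) (hx : x ≤ N) :
    ((1 - X : ℝ[X]) ^ x * (1 + X) ^ (N - x)).coeff n
      = ∑ k ∈ range (n + 1), (x.choose k : ℝ) * (-2) ^ k * ((N - k).choose (n - k) : ℝ) := by
  have h1 : (1 - X : ℝ[X]) ^ x * (1 + X) ^ (N - x)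
      = ∑ k ∈ range (x + 1), C ((x.choose k : ℝ) * (-2) ^ k) * (X ^ k * (1 + X) ^ (N - k)) := by
    rw [show (1 - X : ℝ[X]) = C (-2) * X + (1 + X) by simp [C_ofNat]; ring, add_pow, sum_mul]
    refine sum_congr rfl fun k hk => ?_
    have hk : k ≤ x := by simpa [Nat.lt_succ_iff] using hk
    rw [show N - k = (x - k) + (N - x) by omega, pow_add]
    simp only [C_mul, C_pow, mul_pow, map_natCast]
    ring
  rw [h1, finsetSum_coeff]
  simp only [coeff_C_mul, coeff_X_pow_mul', coeff_one_add_X_pow]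
  set f : ℕ → ℝ := fun k => (x.choose k : ℝ) * (-2) ^ k *
    if k ≤ n then ((N - k).choose (n - k) : ℝ) else 0 with hf
  have e1 : ∑ k ∈ range (x + 1), f k = ∑ k ∈ range (x + n + 1), f k := by
    refine sum_subset (range_mono (by omega)) fun k _ hk => ?_
    simp only [mem_range, not_lt] at hk
    simp [hf, Nat.choose_eq_zero_of_lt (show x < k by omega)]
  have e2 : ∑ k ∈ range (n + 1), f k = ∑ k ∈ range (x + n + 1), f k := by
    refine sum_subset (range_mono (by omega)) fun k _ hk => ?_
    simp only [mem_range, not_lt] at hk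
    simp [hf, show ¬ k ≤ n by omega]
  refine (e1.trans e2.symm).trans (sum_congr rfl fun k hk => ?_)
  have hk : k ≤ n := by simpa [Nat.lt_succ_iff] using hk
  simp [hf, hk]

open Polynomial in
lemma coeff_one_sub (j n : ℕ) : ((1 - X : ℝ[X]) ^ j).coeff n = (-1) ^ n * (j.choose n : ℝ) := by
  have : (1 - X : ℝ[X]) ^ j = ((1 + X) ^ j).comp (C (-1) * X) := by simp; ring
  rw [this, comp_C_mul_X_coeff, coeff_one_add_X_pow, mul_comm]

open Polynomial in
lemma coeff_rhs (m s i : ℕ) (hi : i ≤ m) :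
    ((2 * X * ∑ k ∈ range (m + 1), (ee s k : ℝ[X]) * (4 * X ^ 2) ^ k * (1 - X ^ 2) ^ (m - k) :
      ℝ[X])).coeff (2 * i + 1)
    = 2 * ∑ k ∈ range (i + 1), (ee s k : ℝ) * 4 ^ k * ((-1) ^ (i - k) * ((m - k).choose (i - k))) := by
  have h : (∑ k ∈ range (m + 1), (ee s k : ℝ[X]) * (4 * X ^ 2) ^ k * (1 - X ^ 2) ^ (m - k) : ℝ[X])
    = expand ℝ 2 (∑ k ∈ range (m + 1), C ((ee s k : ℝ) * 4 ^ k) * (X ^ k * (1 - X) ^ (m - k))) := by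
    rw [map_sum]
    refine sum_congr rfl fun k _ => ?_
    have h4 : (C 4 : ℝ[X]) = 4 := map_ofNat _ 4
    simp [mul_pow]; rw [h4]; ring
  rw [h, show (2 * X : ℝ[X]) = C 2 * X by simp [C_ofNat], mul_assoc, coeff_C_mul, coeff_X_mul,
    mul_comm 2 i, coeff_expand_mul (by norm_num), finsetSum_coeff]
  congr 1
  simp only [coeff_C_mul, coeff_X_pow_mul', coeff_one_sub]
  rw [← sum_subset (range_mono (Nat.succ_le_succ hi))]
  · refine sum_congr rfl fun k hk => ?_
    have hk : k ≤ i := by simpa [Nat.lt_succ_iff] using hk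
    simp [hk]
  · intro k _ hk
    simp only [mem_range, not_lt] at hk
    simp [show ¬ k ≤ i by omega]

open Polynomial in
lemma key (m i s : ℕ) (hi : i ≤ m) (hs : s ≤ m) :
    - ∑ k ∈ range (2 * i + 2), ((m + s + 1).choose k : ℝ) * (-2) ^ k *
        ((2 * m + 1 - k).choose (2 * i + 1 - k) : ℝ)
    = ∑ k ∈ range (i + 1), (ee s k : ℝ) * 4 ^ k * ((-1) ^ (i - k) * ((m - k).choose (i - k))) := by
  have h := congrArg (fun p => coeff p (2 * i + 1)) (odd_id (X : ℝ[X]) m s hs)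
  simp only [coeff_rhs m s i hi, coeff_sub] at h
  have hc : (1 + X : ℝ[X]) ^ (m + s + 1) * (1 - X) ^ (m - s)
     = ((1 - X : ℝ[X]) ^ (m + s + 1) * (1 + X) ^ (m - s)).comp (C (-1) * X) := by
    simp only [mul_comp, pow_comp, sub_comp, add_comp, one_comp, X_comp, C_neg, C_1]; ring
  rw [hc, comp_C_mul_X_coeff] at h
  have hk := coeff_kraw (m + s + 1) (2 * m + 1) (2 * i + 1) (by omega)
  rw [show 2 * m + 1 - (m + s + 1) = m - s by omega] at hk
  rw [hk, Odd.neg_one_pow ⟨i, rfl⟩] at h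
  linarith

lemma poch_neg (a k : ℕ) : poch (-(a : ℝ)) k = (-1) ^ k * (a.descFactorial k : ℝ) := by
  induction k with
  | zero => simp [poch]
  | succ k ih =>
    unfold poch at *
    rw [prod_range_succ, ih, Nat.descFactorial_succ]
    rcases le_or_gt k a with h | h
    · push_cast [Nat.cast_sub h]; ring
    · rw [Nat.descFactorial_of_lt h]; simp

lemma poch_pos (s k : ℕ) : (s.factorial : ℝ) * poch ((s : ℝ) + 1) k = (s + k).factorial := by
  induction k with
  | zero => simp [poch]
  | succ k ih =>
    unfold poch at *
    rw [prod_range_succ, ← mul_assoc, ih, ← add_assoc, Nat.factorial_succ]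
    push_cast; ring

lemma poch_half (k : ℕ) : (k.factorial : ℝ) * poch (3 / 2) k * 4 ^ k = (2 * k + 1).factorial := by
  induction k with
  | zero => simp [poch]
  | succ k ih =>
    unfold poch at *
    rw [prod_range_succ, show 2 * (k + 1) + 1 = 2 * k + 1 + 1 + 1 by ring, Nat.factorial_succ (2 * k + 1 + 1),
      Nat.factorial_succ (2 * k + 1), Nat.factorial_succ k]
    push_cast
    rw [← ih]; ring

lemma choose_desc (N n k : ℕ) (hk : k ≤ n) (hn : n ≤ N) :
    (N.choose n : ℝ) * (n.descFactorial k / N.descFactorial k) = ((N - k).choose (n - k) : ℝ) := by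
  have h := Nat.choose_mul (n := N) (k := n) (s := k) hk
  have h0 : (N.descFactorial k : ℝ) ≠ 0 := by
    exact_mod_cast (Nat.descFactorial_pos.2 (hk.trans hn)).ne'
  rw [← mul_div_assoc, div_eq_iff h0]
  rw [Nat.descFactorial_eq_factorial_mul_choose, Nat.descFactorial_eq_factorial_mul_choose]
  have h' := congrArg (Nat.cast (R := ℝ)) h
  push_cast at h' ⊢
  linear_combination (k.factorial : ℝ) * h'

lemma right_term (N n x k : ℕ) (hk : k ≤ n) (hn : n ≤ N) :
    (N.choose n : ℝ) * (poch (-(n : ℝ)) k * poch (-(x : ℝ)) k / (poch (-(N : ℝ)) k * k.factorial)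
      * 2 ^ k) = (x.choose k : ℝ) * (-2) ^ k * ((N - k).choose (n - k) : ℝ) := by
  rw [← choose_desc N n k hk hn, poch_neg, poch_neg, poch_neg,
    Nat.descFactorial_eq_factorial_mul_choose x]
  have h0 : (N.descFactorial k : ℝ) ≠ 0 := by
    exact_mod_cast (Nat.descFactorial_pos.2 (hk.trans hn)).ne'
  have h1 : (k.factorial : ℝ) ≠ 0 := by positivity
  rw [show (-2 : ℝ) = (-1) * 2 by norm_num, mul_pow]
  push_cast
  field_simp

lemma left_term (m i s k : ℕ) (hk : k ≤ i) (hi : i ≤ m) :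
    (2 * (s : ℝ) + 1) * (m.choose i : ℝ) * (poch (-(s : ℝ)) k * poch ((s : ℝ) + 1) k *
      poch (-(i : ℝ)) k / ((k.factorial : ℝ) * poch (3 / 2) k * poch (-(m : ℝ)) k))
    = (ee s k : ℝ) * 4 ^ k * ((-1) ^ k * ((m - k).choose (i - k))) := by
  rw [← choose_desc m i k hk hi, poch_neg, poch_neg, poch_neg]
  have h0 : (m.descFactorial k : ℝ) ≠ 0 := by
    exact_mod_cast (Nat.descFactorial_pos.2 (hk.trans hi)).ne'
  have h1 : (k.factorial : ℝ) * poch (3 / 2) k = (2 * k + 1).factorial / 4 ^ k := by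
    rw [← poch_half]; field_simp
  have h2 : (2 * (s : ℝ) + 1) * s.descFactorial k * poch ((s : ℝ) + 1) k
      = (2 * k + 1).factorial * ee s k := by
    rcases le_or_gt k s with h | h
    · have a := congrArg (Nat.cast (R := ℝ)) (ee_closed s k h)
      have b := congrArg (Nat.cast (R := ℝ)) (Nat.factorial_mul_descFactorial h)
      have c := poch_pos s k
      push_cast at a b
      have d : ((s - k).factorial : ℝ) ≠ 0 := by positivity
      apply mul_left_cancel₀ d
      rw [← c] at a
      linear_combination (2 * (s : ℝ) + 1) * poch ((s : ℝ) + 1) k * b - a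
    · rw [Nat.descFactorial_of_lt h, ee_zero s k h]; simp
  rw [h1]
  have h3 : ((2 * k + 1).factorial : ℝ) ≠ 0 := by positivity
  field_simp
  linear_combination ((m.choose i : ℝ) * i.descFactorial k) * h2

/-- Reduction of Hahn polynomials with parameters `(1/2,-1/2)` to symmetric Krawtchouk
polynomials of odd degree:
`₃F₂(-s,s+1,-i;3/2,-m;1) = -((-1)^i/(2s+1)) (C(2m+1,2i+1)/C(m,i)) ₂F₁(-2i-1,-m-s-1;-2m-1;2)`. -/
theorem hahn_to_krawtchouk_odd (m i s : ℕ) (hi : i ≤ m) (hs : s ≤ m) :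
    ∑ k ∈ Finset.range (i + 1),
        poch (-(s : ℝ)) k * poch ((s : ℝ) + 1) k * poch (-(i : ℝ)) k /
          ((k.factorial : ℝ) * poch (3 / 2) k * poch (-(m : ℝ)) k)
      = -((-1 : ℝ) ^ i / (2 * (s : ℝ) + 1))
          * ((Nat.choose (2 * m + 1) (2 * i + 1) : ℝ) / (Nat.choose m i : ℝ))
          * ∑ k ∈ Finset.range (2 * i + 2),
              poch (-(2 * (i : ℝ)) - 1) k * poch (-((m : ℝ) + s + 1)) k /
                (poch (-(2 * (m : ℝ)) - 1) k * (k.factorial : ℝ)) * 2 ^ k := by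
  have hc : (m.choose i : ℝ) ≠ 0 := by exact_mod_cast (Nat.choose_pos hi).ne'
  have hs1 : (2 * (s : ℝ) + 1) ≠ 0 := by positivity
  have hk := key m i s hi hs
  have hR : ((2 * m + 1).choose (2 * i + 1) : ℝ) * ∑ k ∈ Finset.range (2 * i + 2),
              poch (-(2 * (i : ℝ)) - 1) k * poch (-((m : ℝ) + s + 1)) k /
                (poch (-(2 * (m : ℝ)) - 1) k * (k.factorial : ℝ)) * 2 ^ k
      = ∑ k ∈ range (2 * i + 2), ((m + s + 1).choose k : ℝ) * (-2) ^ k *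
        ((2 * m + 1 - k).choose (2 * i + 1 - k) : ℝ) := by
    rw [mul_sum]
    refine sum_congr rfl fun k hk => ?_
    have hk : k ≤ 2 * i + 1 := by simp at hk; omega
    rw [← right_term _ _ _ _ hk (by omega)]
    push_cast
    rw [show -(2 * (i : ℝ) + 1) = -(2 * (i : ℝ)) - 1 by ring,
      show -(2 * (m : ℝ) + 1) = -(2 * (m : ℝ)) - 1 by ring]
  have hL : (2 * (s : ℝ) + 1) * (m.choose i : ℝ) * ∑ k ∈ Finset.range (i + 1),
        poch (-(s : ℝ)) k * poch ((s : ℝ) + 1) k * poch (-(i : ℝ)) k /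
          ((k.factorial : ℝ) * poch (3 / 2) k * poch (-(m : ℝ)) k)
      = (-1) ^ i * ∑ k ∈ range (i + 1),
        (ee s k : ℝ) * 4 ^ k * ((-1) ^ (i - k) * ((m - k).choose (i - k))) := by
    rw [mul_sum, mul_sum]
    refine sum_congr rfl fun k hk => ?_
    have hk : k ≤ i := by simpa [Nat.lt_succ_iff] using hk
    rw [left_term m i s k hk hi]
    have e : (-1 : ℝ) ^ i * (-1) ^ (i - k) = (-1) ^ k := by
      obtain ⟨j, rfl⟩ := Nat.exists_eq_add_of_le hk
      rw [show k + j - k = j by omega, pow_add, mul_assoc, ← mul_pow]; simp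
    rw [← e]; ring
  rw [← hk, ← hR] at hL
  apply mul_left_cancel₀ (mul_ne_zero hs1 hc)
  rw [hL]
  field_simp
end
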